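/- arXiv:2302.04402 — 3 statements merged into one kernel-verified Lean document; each statement's English description precedes it below -/
import Mathlib

section
/- Let B be a non-degenerate Boolean algebra and let Y, Z be B-sets. Then: (1) the set Z^Y of B-set homomorphisms Y → Z is closed under the pointwise operations b(f,g)(y) = b(f(y), g(y)), which make Z^Y a B-set; (2) the evaluation map ev : Z^Y × Y → Z, ev(f, y) = f(y), is a B-set homomorphism (where the product carries the componentwise B-set structure); and (3) for every B-set X and every B-set homomorphism f : X × Y → Z there is a unique B-set homomorphism f̄ : X → Z^Y with ev(f̄(x), y) = f(x, y), namely f̄(x) = f(x, −). Hence the category of B-sets is cartesian closed. -/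
/-- A `B`-set structure on `X`, for a Boolean algebra `B`. -/
structure BSetStruct (B : Type) [BooleanAlgebra B] (X : Type) where
  act : B → X → X → X
  act_refl : ∀ b x, act b x x = x
  act_absorb_left : ∀ b x y z, act b (act b x y) z = act b x z
  act_absorb_right : ∀ b x y z, act b x (act b y z) = act b x z
  act_top : ∀ x y, act ⊤ x y = x
  act_compl : ∀ b x y, act bᶜ x y = act b y x
  act_inf : ∀ b c x y, act (b ⊓ c) x y = act b (act c x y) y

/-- The relation `x ≡_b y`, i.e. `b(x,y) = y`. -/
def BSetStruct.eqv {B X : Type} [BooleanAlgebra B] (S : BSetStruct B X)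
    (b : B) (x y : X) : Prop :=
  S.act b x y = y

/-- A homomorphism of `B`-sets. -/
def IsBSetHom {B X Y : Type} [BooleanAlgebra B]
    (SX : BSetStruct B X) (SY : BSetStruct B Y) (f : X → Y) : Prop :=
  ∀ b x y, f (SX.act b x y) = SY.act b (f x) (f y)

/-- The product of two `B`-sets, with componentwise operations. -/
def prodBSet {B X Y : Type} [BooleanAlgebra B]
    (SX : BSetStruct B X) (SY : BSetStruct B Y) : BSetStruct B (X × Y) where
  act b p q := (SX.act b p.1 q.1, SY.act b p.2 q.2)
  act_refl b x := by simp [SX.act_refl, SY.act_refl]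
  act_absorb_left b x y z := by simp [SX.act_absorb_left, SY.act_absorb_left]
  act_absorb_right b x y z := by simp [SX.act_absorb_right, SY.act_absorb_right]
  act_top x y := by simp [SX.act_top, SY.act_top]
  act_compl b x y := by simp [SX.act_compl, SY.act_compl]
  act_inf b c x y := by simp [SX.act_inf, SY.act_inf]

namespace BSetStruct

variable {B X : Type} [BooleanAlgebra B] (S : BSetStruct B X)

theorem eqv_iff {b : B} {x y : X} : S.eqv b x y ↔ ∀ w, S.act b x w = S.act b y w := by
  refine ⟨fun h w => ?_, fun h => ?_⟩
  · rw [← S.act_absorb_left b x y w, show S.act b x y = y from h]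
  · exact (h y).trans (S.act_refl b y)

theorem eqv_symm {b : B} {x y : X} (h : S.eqv b x y) : S.eqv b y x :=
  S.eqv_iff.2 fun w => (S.eqv_iff.1 h w).symm

theorem eqv_trans {b : B} {x y z : X} (hxy : S.eqv b x y) (hyz : S.eqv b y z) :
    S.eqv b x z :=
  S.eqv_iff.2 fun w => (S.eqv_iff.1 hxy w).trans (S.eqv_iff.1 hyz w)

theorem eqv_inf_right {b : B} (c : B) {x y : X} (h : S.eqv b x y) : S.eqv (c ⊓ b) x y := by
  rw [eqv, S.act_inf, show S.act b x y = y from h, S.act_refl]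

theorem eqv_inf_left {b : B} (c : B) {x y : X} (h : S.eqv b x y) : S.eqv (b ⊓ c) x y :=
  inf_comm c b ▸ S.eqv_inf_right c h

theorem eq_of_eqv_of_eqv_compl {b : B} {x y : X} (h : S.eqv b x y) (h' : S.eqv bᶜ x y) :
    x = y := by
  have hx : S.act b y x = x := S.eqv_symm h
  rw [eqv, S.act_compl] at h'
  exact hx.symm.trans h'

theorem eqv_of_eqv_inf {b c : B} {x y : X} (h : S.eqv (b ⊓ c) x y)
    (h' : S.eqv (b ⊓ cᶜ) x y) : S.eqv b x y := by
  rw [inf_comm, eqv, S.act_inf] at h h'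
  exact S.eq_of_eqv_of_eqv_compl h h'

theorem act_eqv_left (b : B) (x y : X) : S.eqv b (S.act b x y) x :=
  S.eqv_iff.2 fun w => S.act_absorb_left b x y w

theorem act_eqv_right (b : B) (x y : X) : S.eqv bᶜ (S.act b x y) y :=
  S.act_compl b y x ▸ S.act_eqv_left bᶜ y x

/-- Any two of the operations of a `B`-set commute with each other. -/
theorem act_act_comm (b c : B) (x y z w : X) :
    S.act b (S.act c x y) (S.act c z w) = S.act c (S.act b x z) (S.act b y w) := by
  refine S.eq_of_eqv_of_eqv_compl (b := b) (S.eqv_of_eqv_inf (c := c) ?_ ?_)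
    (S.eqv_of_eqv_inf (c := c) ?_ ?_)
  · exact S.eqv_trans
      (S.eqv_trans (S.eqv_inf_left _ (S.act_eqv_left ..)) (S.eqv_inf_right _ (S.act_eqv_left ..)))
      (S.eqv_symm (S.eqv_trans (S.eqv_inf_right _ (S.act_eqv_left ..))
        (S.eqv_inf_left _ (S.act_eqv_left ..))))
  · exact S.eqv_trans
      (S.eqv_trans (S.eqv_inf_left _ (S.act_eqv_left ..)) (S.eqv_inf_right _ (S.act_eqv_right ..)))
      (S.eqv_symm (S.eqv_trans (S.eqv_inf_right _ (S.act_eqv_right ..))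
        (S.eqv_inf_left _ (S.act_eqv_left ..))))
  · exact S.eqv_trans
      (S.eqv_trans (S.eqv_inf_left _ (S.act_eqv_right ..)) (S.eqv_inf_right _ (S.act_eqv_left ..)))
      (S.eqv_symm (S.eqv_trans (S.eqv_inf_right _ (S.act_eqv_left ..))
        (S.eqv_inf_left _ (S.act_eqv_right ..))))
  · exact S.eqv_trans
      (S.eqv_trans (S.eqv_inf_left _ (S.act_eqv_right ..))
        (S.eqv_inf_right _ (S.act_eqv_right ..)))
      (S.eqv_symm (S.eqv_trans (S.eqv_inf_right _ (S.act_eqv_right ..))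
        (S.eqv_inf_left _ (S.act_eqv_right ..))))

end BSetStruct

/-- The `B`-set of homomorphisms `Y → Z`, with pointwise operations. -/
def homBSet {B Y Z : Type} [BooleanAlgebra B] (SY : BSetStruct B Y) (SZ : BSetStruct B Z) :
    BSetStruct B {f : Y → Z // IsBSetHom SY SZ f} where
  act b f g := ⟨fun y => SZ.act b (f.1 y) (g.1 y), fun c x y => by
    simp only [f.2 c, g.2 c, SZ.act_act_comm b c]⟩
  act_refl _ _ := Subtype.ext <| funext fun _ => SZ.act_refl _ _
  act_absorb_left _ _ _ _ := Subtype.ext <| funext fun _ => SZ.act_absorb_left _ _ _ _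
  act_absorb_right _ _ _ _ := Subtype.ext <| funext fun _ => SZ.act_absorb_right _ _ _ _
  act_top _ _ := Subtype.ext <| funext fun _ => SZ.act_top _ _
  act_compl _ _ _ := Subtype.ext <| funext fun _ => SZ.act_compl _ _ _
  act_inf _ _ _ _ := Subtype.ext <| funext fun _ => SZ.act_inf _ _ _ _

/-- The variety of `B`-sets is cartesian closed: the set of `B`-set
homomorphisms `Y → Z` is a `B`-set under the pointwise operations, and with
the usual evaluation and transposition it is an exponential. -/
theorem bset_cartesian_closed (B Y Z : Type) [BooleanAlgebra B]
    (nondeg : (⊥ : B) ≠ ⊤)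
    (SY : BSetStruct B Y) (SZ : BSetStruct B Z) :
    ∃ SE : BSetStruct B {f : Y → Z // IsBSetHom SY SZ f},
      -- (1) the pointwise operations preserve homomorphisms and give the
      -- `B`-set structure of `Z^Y`
      (∀ (b : B) (f g : {f : Y → Z // IsBSetHom SY SZ f}) (y : Y),
        (SE.act b f g).1 y = SZ.act b (f.1 y) (g.1 y)) ∧
      -- (2) evaluation is a homomorphism
      IsBSetHom (prodBSet SE SY) SZ (fun p => p.1.1 p.2) ∧
      -- (3) unique transposition: `f̄(x) = f(x, −)`
      (∀ (X : Type) (SX : BSetStruct B X) (f : X × Y → Z),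
        IsBSetHom (prodBSet SX SY) SZ f →
        ∃! g : X → {f : Y → Z // IsBSetHom SY SZ f},
          IsBSetHom SX SE g ∧ ∀ (x : X) (y : Y), (g x).1 y = f (x, y)) := by
  refine ⟨homBSet SY SZ, fun _ _ _ _ => rfl, ?_, fun X SX f hf => ?_⟩
  · rintro b ⟨f, x⟩ ⟨g, y⟩
    change SZ.act b (f.1 (SY.act b x y)) (g.1 (SY.act b x y)) = SZ.act b (f.1 x) (g.1 y)
    rw [f.2, g.2, SZ.act_absorb_left, SZ.act_absorb_right]
  · have hom_right (x : X) : IsBSetHom SY SZ fun y => f (x, y) := fun b y y' => by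
      simpa only [prodBSet, SX.act_refl] using hf b (x, y) (x, y')
    have hom_left (y : Y) : IsBSetHom SX SZ fun x => f (x, y) := fun b x x' => by
      simpa only [prodBSet, SY.act_refl] using hf b (x, y) (x', y)
    refine ⟨fun x => ⟨fun y => f (x, y), hom_right x⟩,
      ⟨fun b x x' => Subtype.ext <| funext fun y => hom_left y b x x', fun _ _ => rfl⟩, ?_⟩
    rintro g ⟨-, hg⟩
    exact funext fun x => Subtype.ext <| funext (hg x)
end

section
/- Let B_𝒥 be a non-degenerate Grothendieck Boolean algebra, X a B_𝒥-set, and x, y ∈ X. Then: (i) for any P ∈ 𝒥 and b ∈ B, if x ≡_{b ⊓ c} y for all c ∈ P, then x ≡_b y; and (ii) for any b ∈ B and any P ∈ 𝒥_b, if x ≡_c y for all c ∈ P, then x ≡_b y. -/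
/-- `P` is a partition of `b`: a set of nonzero pairwise-disjoint elements
whose supremum exists and equals `b`. -/
def IsPartitionOf {B : Type} [BooleanAlgebra B] (P : Set B) (b : B) : Prop :=
  (∀ c ∈ P, c ≠ ⊥) ∧ (∀ c ∈ P, ∀ d ∈ P, c ≠ d → c ⊓ d = ⊥) ∧ IsLUB P b

/-- A zero-dimensional topology on a Boolean algebra `B`: a collection `J` of
partitions of `1` containing all finite partitions, closed under refinement and
under images along surjections. -/
structure ZeroDimTopology (B : Type) [BooleanAlgebra B] where
  J : Set (Set B)
  partitions : ∀ P ∈ J, IsPartitionOf P ⊤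
  finite_mem : ∀ P : Set B, IsPartitionOf P ⊤ → P.Finite → P ∈ J
  refine : ∀ P ∈ J, ∀ Q : B → Set B, (∀ b ∈ P, Q b ∈ J) →
      ({d : B | ∃ b ∈ P, ∃ c ∈ Q b, d = b ⊓ c} \ {⊥}) ∈ J
  glue : ∀ (P : Set B), P ∈ J → ∀ (I : Type) (α : P → I), Function.Surjective α →
      (∀ i : I, ∃ s : B, IsLUB (Subtype.val '' (α ⁻¹' {i})) s) ∧
      {s : B | ∃ i : I, IsLUB (Subtype.val '' (α ⁻¹' {i})) s} ∈ J

/-- A `B_𝒥`-set: a `B`-set together with an operation `X^P → X` for each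
infinite partition `P ∈ 𝒥`, satisfying the three axioms. -/
structure BJSetStruct (B : Type) [BooleanAlgebra B] (𝒥 : ZeroDimTopology B)
    (X : Type) extends BSetStruct B X where
  pop : ∀ (P : Set B), P ∈ 𝒥.J → P.Infinite → (P → X) → X
  pop_const : ∀ (P : Set B) (hP : P ∈ 𝒥.J) (hinf : P.Infinite) (x : X),
      pop P hP hinf (fun _ => x) = x
  pop_act : ∀ (P : Set B) (hP : P ∈ 𝒥.J) (hinf : P.Infinite) (x y : P → X),
      pop P hP hinf (fun b => act b.1 (x b) (y b)) = pop P hP hinf x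
  act_pop : ∀ (P : Set B) (hP : P ∈ 𝒥.J) (hinf : P.Infinite) (x : P → X) (b : P),
      act b.1 (pop P hP hinf x) (x b) = x b

namespace BSetStruct

variable {B X : Type} [BooleanAlgebra B] (S : BSetStruct B X)

theorem eqv_bot (x y : X) : S.eqv ⊥ x y := by
  rw [eqv, ← compl_top, S.act_compl, S.act_top]

theorem eqv_sup {a b : B} {x y : X} (ha : S.eqv a x y) (hb : S.eqv b x y) :
    S.eqv (a ⊔ b) x y := by
  unfold eqv at *
  rw [← compl_compl (a ⊔ b), S.act_compl, compl_sup, S.act_inf, S.act_compl b, hb,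
    S.act_compl, ha]

theorem eqv_finset_sup {s : Finset B} {x y : X} (h : ∀ c ∈ s, S.eqv c x y) :
    S.eqv (s.sup id) x y :=
  Finset.sup_induction (p := fun b => S.eqv b x y) (S.eqv_bot x y)
    (fun _ ha _ hb => S.eqv_sup ha hb) h

theorem eqv_top_iff {x y : X} : S.eqv ⊤ x y ↔ x = y := by
  rw [eqv, S.act_top]

theorem eqv_act_left {b c : B} {x y : X} :
    S.eqv c (S.act b x y) y ↔ S.eqv (b ⊓ c) x y := by
  rw [eqv, eqv, inf_comm, S.act_inf]

end BSetStruct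

theorem BJSetStruct.eq_of_forall_eqv {B X : Type} [BooleanAlgebra B]
    {𝒥 : ZeroDimTopology B} (T : BJSetStruct B 𝒥 X) {P : Set B} (hP : P ∈ 𝒥.J) {x y : X}
    (h : ∀ c ∈ P, T.toBSetStruct.eqv c x y) : x = y := by
  rcases P.finite_or_infinite with hfin | hinf
  · rw [← T.eqv_top_iff]
    have hlub : IsLUB P (hfin.toFinset.sup id) := by
      simpa using Finset.isLUB_sup_id (s := hfin.toFinset)
    rw [(𝒥.partitions P hP).2.2.unique hlub]
    exact T.eqv_finset_sup fun c hc => h c (hfin.mem_toFinset.1 hc)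
  · have hact := T.pop_act P hP hinf (fun _ => x) (fun _ => y)
    rw [show (fun c : P => T.act c.1 x y) = fun _ => y from funext fun c => h c.1 c.2,
      T.pop_const, T.pop_const] at hact
    exact hact.symm

/-- Lemma 1 of the paper: (i) if `x ≡_{b ⊓ c} y` for all `c` in some `P ∈ 𝒥`,
then `x ≡_b y`; (ii) if `P ∈ 𝒥_b` and `x ≡_c y` for all `c ∈ P`, then
`x ≡_b y`.  Here `𝒥_b` consists of the partitions `P` of `b` with
`(P ∪ {bᶜ}) \ {⊥} ∈ 𝒥`. -/
theorem bjset_local_partition_lemma (B X : Type) [BooleanAlgebra B]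
    (nondeg : (⊥ : B) ≠ ⊤) (𝒥 : ZeroDimTopology B)
    (T : BJSetStruct B 𝒥 X) (x y : X) :
    (∀ P ∈ 𝒥.J, ∀ b : B,
      (∀ c ∈ P, T.toBSetStruct.eqv (b ⊓ c) x y) → T.toBSetStruct.eqv b x y) ∧
    (∀ (b : B) (P : Set B), IsPartitionOf P b → ((P ∪ {bᶜ}) \ {⊥}) ∈ 𝒥.J →
      (∀ c ∈ P, T.toBSetStruct.eqv c x y) → T.toBSetStruct.eqv b x y) := by
  have local_of_cover : ∀ P ∈ 𝒥.J, ∀ b : B,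
      (∀ c ∈ P, T.toBSetStruct.eqv (b ⊓ c) x y) → T.toBSetStruct.eqv b x y :=
    fun P hP b h => T.eq_of_forall_eqv hP fun c hc => T.eqv_act_left.2 (h c hc)
  refine ⟨local_of_cover, fun b P hPb hP h => local_of_cover _ hP b ?_⟩
  rintro c ⟨hc | rfl, -⟩
  · rw [inf_eq_right.2 (hPb.2.2.1 hc)]
    exact h c hc
  · rw [inf_compl_self]
    exact T.eqv_bot x y
end

section
/- Let 𝕋 be a non-degenerate hyperaffine algebraic theory and B = T(2) its Boolean algebra (with 1 = π_1, 0 = π_2, b ⊓ c = b(c(π_1,π_2),π_2), b ⊔ c = b(π_1,c(π_1,π_2)), bᶜ = b(π_2,π_1)). For t, u ∈ T(I): (i) if t^{(i)} = u^{(i)} for all i ∈ I, then t = u; (ii) if i ≠ j in I, then t^{(i)} ⊓ t^{(j)} = 0 in B; (iii) for every U ⊆ I, the supremum ⨆_{i∈U} t^{(i)} exists in B and equals t^{(U)}. -/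
/-- An (infinitary) algebraic theory. -/
structure AlgTheory where
  T : Type → Type
  pr : ∀ {I : Type}, I → T I
  subst : ∀ {I J : Type}, T I → (I → T J) → T J
  subst_pr : ∀ {I : Type} (t : T I), subst t (fun i => pr i) = t
  pr_subst : ∀ {I J : Type} (i : I) (u : I → T J), subst (pr i) u = u i
  subst_assoc : ∀ {I J K : Type} (t : T I) (u : I → T J) (v : J → T K),
      subst (subst t u) v = subst t (fun i => subst (u i) v)

def AlgTheory.IsAffine (𝕋 : AlgTheory) {I : Type} (t : 𝕋.T I) : Prop :=
  𝕋.subst t (fun _ => 𝕋.pr PUnit.unit) = 𝕋.pr PUnit.unit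

def AlgTheory.IsHyperaffine (𝕋 : AlgTheory) {I : Type} (t : 𝕋.T I) : Prop :=
  𝕋.IsAffine t ∧
  𝕋.subst t (fun i => 𝕋.subst t (fun j => 𝕋.pr (i, j))) =
    𝕋.subst t (fun i => 𝕋.pr (i, i))

/-- `b(c,d)` for binary operations, with `2` modelled by `Bool`,
`π₁ = pr true`, `π₂ = pr false`. -/
def AlgTheory.sub2 (𝕋 : AlgTheory) (b c d : 𝕋.T Bool) : 𝕋.T Bool :=
  𝕋.subst b (fun i => if i then c else d)

-- The binary reduct `t^{(U)} ∈ T 2` of `t ∈ T I` along `U ⊆ I`.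
open Classical in
noncomputable def AlgTheory.reduct (𝕋 : AlgTheory) {I : Type} (t : 𝕋.T I) (U : Set I) :
    𝕋.T Bool :=
  𝕋.subst t (fun i => if i ∈ U then 𝕋.pr true else 𝕋.pr false)

namespace AlgTheory

variable {𝕋 : AlgTheory} {I J K : Type}

theorem IsAffine.subst_const {t : 𝕋.T I} (ht : 𝕋.IsAffine t) (x : 𝕋.T J) :
    𝕋.subst t (fun _ => x) = x := by
  have h := congrArg (fun s => 𝕋.subst s (fun _ : PUnit => x)) ht
  simpa only [𝕋.subst_assoc, 𝕋.pr_subst] using h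

theorem IsHyperaffine.subst_diag {t : 𝕋.T I} (ht : 𝕋.IsHyperaffine t) (f : I → I → 𝕋.T J) :
    𝕋.subst t (fun i => 𝕋.subst t (fun j => f i j)) = 𝕋.subst t (fun i => f i i) := by
  have h := congrArg (fun s => 𝕋.subst s (fun p : I × I => f p.1 p.2)) ht.2
  simpa only [𝕋.subst_assoc, 𝕋.pr_subst] using h

/-- Operations of a hyperaffine theory commute with each other. -/
theorem subst_comm_of_hyperaffine (hyp : ∀ (I : Type) (t : 𝕋.T I), 𝕋.IsHyperaffine t)
    (t : 𝕋.T I) (u : 𝕋.T J) (f : I → J → 𝕋.T K) :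
    𝕋.subst t (fun i => 𝕋.subst u (fun j => f i j)) =
      𝕋.subst u (fun j => 𝕋.subst t (fun i => f i j)) := by
  have h := (hyp _ (𝕋.subst t (fun i => 𝕋.subst u (fun j => 𝕋.pr (i, j))))).subst_diag
    (fun p q => f q.1 p.2)
  simp only [𝕋.subst_assoc, 𝕋.pr_subst, (hyp _ u).1.subst_const] at h
  rw [(hyp _ t).1.subst_const] at h
  exact h.symm

open Classical in
/-- An operation applied to a family is determined by its restrictions to singletons. -/
theorem IsHyperaffine.subst_eq_of_forall_single {t : 𝕋.T I} (ht : 𝕋.IsHyperaffine t)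
    (f g : I → 𝕋.T J) (y : 𝕋.T J)
    (h : ∀ i, 𝕋.subst t (fun a => if a = i then f i else y) =
      𝕋.subst t (fun a => if a = i then g i else y)) :
    𝕋.subst t f = 𝕋.subst t g := by
  have hf := ht.subst_diag (fun i a => if a = i then f i else y)
  have hg := ht.subst_diag (fun i a => if a = i then g i else y)
  simp only [if_true] at hf hg
  rw [← hf, ← hg]
  exact congrArg _ (funext h)

open Classical in
theorem subst_reduct (t : 𝕋.T I) (U : Set I) (f : Bool → 𝕋.T J) :
    𝕋.subst (𝕋.reduct t U) f = 𝕋.subst t (fun i => if i ∈ U then f true else f false) := by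
  rw [reduct, 𝕋.subst_assoc]
  congr 1
  funext i
  split_ifs <;> rw [𝕋.pr_subst]

open Classical in
theorem eq_of_reduct_singleton_eq (hyp : ∀ (I : Type) (t : 𝕋.T I), 𝕋.IsHyperaffine t)
    {t u : 𝕋.T I} (h : ∀ i : I, 𝕋.reduct t {i} = 𝕋.reduct u {i}) : t = u := by
  have transfer (i : I) (x y : 𝕋.T I) : 𝕋.subst t (fun a => if a = i then x else y) =
      𝕋.subst u (fun a => if a = i then x else y) := by
    have := congrArg (fun s => 𝕋.subst s (fun b : Bool => if b then x else y)) (h i)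
    simpa [subst_reduct] using this
  have ht := (hyp _ t).subst_diag (fun i a => if a = i then 𝕋.pr i else t)
  have hu := (hyp _ u).subst_diag (fun i a => if a = i then 𝕋.pr i else t)
  simp only [if_true, 𝕋.subst_pr] at ht hu
  rw [← ht, ← hu]
  simp only [transfer]
  rw [subst_comm_of_hyperaffine hyp]
  simp only [← transfer]
  congr 1
  funext j
  congr 1
  funext i
  by_cases hij : i = j
  · subst hij
    rfl
  · rw [if_neg hij, if_neg (Ne.symm hij)]

open Classical in
theorem sub2_reduct (t : 𝕋.T I) (U : Set I) (c d : 𝕋.T Bool) :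
    𝕋.sub2 (𝕋.reduct t U) c d = 𝕋.subst t (fun i => if i ∈ U then c else d) := by
  simp [sub2, subst_reduct]

theorem sub2_pr_true_pr_false (b : 𝕋.T Bool) : 𝕋.sub2 b (𝕋.pr true) (𝕋.pr false) = b := by
  conv_rhs => rw [← 𝕋.subst_pr b]
  rw [sub2]
  congr 1
  funext i
  cases i <;> rfl

theorem sub2_reduct_reduct (hyp : ∀ (I : Type) (t : 𝕋.T I), 𝕋.IsHyperaffine t)
    (t : 𝕋.T I) (U V : Set I) :
    𝕋.sub2 (𝕋.reduct t U) (𝕋.reduct t V) (𝕋.pr false) = 𝕋.reduct t (U ∩ V) := by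
  classical
  have h := (hyp _ t).subst_diag
    (fun i j => if i ∈ U then if j ∈ V then 𝕋.pr true else 𝕋.pr false else 𝕋.pr false)
  rw [sub2_reduct]
  refine Eq.trans (congrArg _ (funext fun i => ?_)) (h.trans (congrArg _ (funext fun i => ?_)))
  · by_cases hi : i ∈ U
    · simp only [hi, if_true, reduct]
    · simp only [hi, if_false, (hyp _ t).1.subst_const]
  · by_cases hi : i ∈ U <;> simp [hi]

theorem reduct_empty (hyp : ∀ (I : Type) (t : 𝕋.T I), 𝕋.IsHyperaffine t) (t : 𝕋.T I) :
    𝕋.reduct t ∅ = 𝕋.pr false := by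
  simp [reduct, (hyp _ t).1.subst_const]

end AlgTheory

/-- Properties of binary reducts in a non-degenerate hyperaffine theory, with
respect to the Boolean algebra structure on `B = T 2`. -/
theorem reduct_properties (𝕋 : AlgTheory)
    (nondeg : (𝕋.pr true : 𝕋.T Bool) ≠ 𝕋.pr false)
    (hyp : ∀ (I : Type) (t : 𝕋.T I), 𝕋.IsHyperaffine t)
    [BooleanAlgebra (𝕋.T Bool)]
    (htop : (⊤ : 𝕋.T Bool) = 𝕋.pr true)
    (hbot : (⊥ : 𝕋.T Bool) = 𝕋.pr false)
    (hinf : ∀ b c : 𝕋.T Bool,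
      b ⊓ c = 𝕋.sub2 b (𝕋.sub2 c (𝕋.pr true) (𝕋.pr false)) (𝕋.pr false))
    (hsup : ∀ b c : 𝕋.T Bool,
      b ⊔ c = 𝕋.sub2 b (𝕋.pr true) (𝕋.sub2 c (𝕋.pr true) (𝕋.pr false)))
    (hcompl : ∀ b : 𝕋.T Bool, bᶜ = 𝕋.sub2 b (𝕋.pr false) (𝕋.pr true))
    (I : Type) :
    (∀ t u : 𝕋.T I, (∀ i : I, 𝕋.reduct t {i} = 𝕋.reduct u {i}) → t = u) ∧
    (∀ (t : 𝕋.T I) (i j : I), i ≠ j → 𝕋.reduct t {i} ⊓ 𝕋.reduct t {j} = ⊥) ∧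
    (∀ (t : 𝕋.T I) (U : Set I),
      IsLUB ((fun i => 𝕋.reduct t {i}) '' U) (𝕋.reduct t U)) := by
  have inf_eq (b c : 𝕋.T Bool) : b ⊓ c = 𝕋.sub2 b c (𝕋.pr false) := by
    rw [hinf, AlgTheory.sub2_pr_true_pr_false]
  have reduct_inf (t : 𝕋.T I) (U V : Set I) :
      𝕋.reduct t U ⊓ 𝕋.reduct t V = 𝕋.reduct t (U ∩ V) := by
    rw [inf_eq, AlgTheory.sub2_reduct_reduct hyp]
  refine ⟨fun t u h => AlgTheory.eq_of_reduct_singleton_eq hyp h, fun t i j hij => ?_,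
    fun t U => ⟨?_, fun c hc => ?_⟩⟩
  · rw [reduct_inf, Set.singleton_inter_eq_empty.2 (by simpa using hij),
      AlgTheory.reduct_empty hyp, hbot]
  · rintro _ ⟨i, hi, rfl⟩
    rw [← inf_eq_left, reduct_inf, Set.inter_eq_left.2 (Set.singleton_subset_iff.2 hi)]
  · classical
    rw [← inf_eq_left, inf_eq, AlgTheory.sub2_reduct, AlgTheory.reduct]
    refine (hyp _ t).subst_eq_of_forall_single _ _ (𝕋.pr false) fun i => ?_
    by_cases hi : i ∈ U
    · have h := inf_eq_left.2 (hc ⟨i, hi, rfl⟩)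
      rw [inf_eq, AlgTheory.sub2_reduct] at h
      simpa [AlgTheory.reduct, hi] using h
    · simp only [hi, if_false]
end
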